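/- (Mountain-pass geometry, part (ii).) Assume (h1), (f1)–(f3), and additionally (nondegeneracy, implicit in the paper's proof) that F(t) > 0 for all t > 0. Then for every ρ > 0 there exists a function e : ℤ^d → ℝ with e ≥ 0, e ≢ 0, ρ < ‖e‖_{H_{s,p}} < ∞ and J̃(e) < 0. -/

import Mathlib

open MeasureTheory Filter Topology
open scoped ENNReal

noncomputable section

namespace DiscreteChoquard

variable {d : ℕ}

/-- The lattice `ℤ^d`. -/
abbrev Z (d : ℕ) := Fin d → ℤ

/-- Graph distance on `ℤ^d`, as a real number. -/
def latDist (x y : Z d) : ℝ := ∑ i, |((x i - y i : ℤ) : ℝ)|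

/-- The kernel hypotheses on `W_s`: symmetry, positivity, and the two-sided bound
`c|x−y|^{−d−2s} ≤ W_s(x,y) ≤ C|x−y|^{−d−2s}` for `x ≠ y`. -/
def KernelOK (d : ℕ) (s : ℝ) (W : Z d → Z d → ℝ) : Prop :=
  (∀ x y, W x y = W y x) ∧ (∀ x y, 0 < W x y) ∧
  ∃ c C : ℝ, 0 < c ∧ c ≤ C ∧ ∀ x y : Z d, x ≠ y →
    c * latDist x y ^ (-(d : ℝ) - 2 * s) ≤ W x y ∧
      W x y ≤ C * latDist x y ^ (-(d : ℝ) - 2 * s)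

/-- The fractional gradient form `∇^s u ∇^s v (x)`.  (The `y = x` summand vanishes, so we
sum over all `y`.) -/
def gradForm (W : Z d → Z d → ℝ) (u v : Z d → ℝ) (x : Z d) : ℝ :=
  (1 / 2) * ∑' y : Z d, W x y * (u x - u y) * (v x - v y)

/-- `|∇^s u|(x)`. -/
def gradNorm (W : Z d → Z d → ℝ) (u : Z d → ℝ) (x : Z d) : ℝ :=
  Real.sqrt ((1 / 2) * ∑' y : Z d, W x y * (u x - u y) ^ 2)

/-- The fractional `p`-Laplacian `(−Δ)_p^s u (x)`. -/
def pLap (W : Z d → Z d → ℝ) (p : ℝ) (u : Z d → ℝ) (x : Z d) : ℝ :=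
  (1 / 2) * ∑' y : Z d,
    W x y * (gradNorm W u x ^ (p - 2) + gradNorm W u y ^ (p - 2)) * (u x - u y)

/-- `‖u‖_{H_{s,p}}^p = ∑_x (|∇^s u|^p(x) + h(x)|u(x)|^p)`. -/
def HnormP (W : Z d → Z d → ℝ) (h : Z d → ℝ) (p : ℝ) (u : Z d → ℝ) : ℝ :=
  ∑' x : Z d, (gradNorm W u x ^ p + h x * |u x| ^ p)

/-- `‖u‖_{H_{s,p}}`. -/
def normH (W : Z d → Z d → ℝ) (h : Z d → ℝ) (p : ℝ) (u : Z d → ℝ) : ℝ :=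
  HnormP W h p u ^ (1 / p)

/-- Membership `u ∈ H_{s,p}`, i.e. `‖u‖_{H_{s,p}} < ∞` (all the defining series converge). -/
def memH (W : Z d → Z d → ℝ) (h : Z d → ℝ) (p : ℝ) (u : Z d → ℝ) : Prop :=
  (∀ x : Z d, Summable fun y : Z d => W x y * (u x - u y) ^ 2) ∧
  Summable fun x : Z d => gradNorm W u x ^ p + h x * |u x| ^ p

/-- The `ℓ^q` norm on `ℤ^d`. -/
def lnorm (q : ℝ) (u : Z d → ℝ) : ℝ := (∑' x : Z d, |u x| ^ q) ^ (1 / q)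

/-- The torus box `[0, 2π]^d`. -/
def box (d : ℕ) : Set (Fin d → ℝ) := Set.univ.pi fun _ => Set.Icc 0 (2 * Real.pi)

/-- `μ(k) = 2d − 2 ∑_j cos k_j`. -/
def muk (d : ℕ) (k : Fin d → ℝ) : ℝ := 2 * d - 2 * ∑ j, Real.cos (k j)

/-- The fractional degree `K_α = (2π)^{-d} ∫_{[0,2π]^d} μ(k)^{α/2} dk`. -/
def Kfrac (d : ℕ) (α : ℝ) : ℝ :=
  (2 * Real.pi) ^ (-(d : ℝ)) * ∫ k in box d, muk d k ^ (α / 2)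

/-- The Green's function `R_α(x,y)` of the discrete fractional Laplacian. -/
def Riesz (d : ℕ) (α : ℝ) (x y : Z d) : ℝ :=
  Kfrac d α * (2 * Real.pi) ^ (-(d : ℝ)) *
    ∫ k in box d, Real.cos (∑ j, ((x j - y j : ℤ) : ℝ) * k j) * muk d k ^ (-(α / 2))

/-- The convolution `(R_α ∗ v)(x) = ∑_y R_α(x,y) v(y)`. -/
def conv (d : ℕ) (α : ℝ) (v : Z d → ℝ) (x : Z d) : ℝ := ∑' y : Z d, Riesz d α x y * v y

/-- `F(t) = ∫_0^t f(r) dr`. -/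
def Fint (f : ℝ → ℝ) (t : ℝ) : ℝ := ∫ r in (0 : ℝ)..t, f r

/-- Positive part `u⁺ = max(u,0)`. -/
def pos (u : Z d → ℝ) (x : Z d) : ℝ := max (u x) 0

/-- Negative part `u⁻ = min(u,0)`. -/
def negp (u : Z d → ℝ) (x : Z d) : ℝ := min (u x) 0

/-- Hypothesis (h2): `h(x) → ∞` as `|x| → ∞`. -/
def H2 (h : Z d → ℝ) : Prop := Tendsto h cofinite atTop

/-- Hypothesis (f1): `f(t) = o(t^{p−1})` as `t → 0⁺`. -/
def F1 (f : ℝ → ℝ) (p : ℝ) : Prop :=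
  ∀ ε > (0 : ℝ), ∃ δ > (0 : ℝ), ∀ t : ℝ, 0 < t → t < δ → |f t| ≤ ε * t ^ (p - 1)

/-- Hypothesis (f3): `0 ≤ θ F(t) ≤ 2 f(t) t` for `t > 0`. -/
def F3 (f : ℝ → ℝ) (θ : ℝ) : Prop :=
  ∀ t > (0 : ℝ), 0 ≤ θ * Fint f t ∧ θ * Fint f t ≤ 2 * f t * t

/-- The energy functional `J̃`. -/
def energy (W : Z d → Z d → ℝ) (h : Z d → ℝ) (p α : ℝ) (f : ℝ → ℝ) (u : Z d → ℝ) : ℝ :=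
  (1 / p) * HnormP W h p u -
    (1 / 2) * ∑' x : Z d, conv d α (fun y => Fint f (pos u y)) x * Fint f (pos u x)

/-- The Nehari set `M`. -/
def Nehari (W : Z d → Z d → ℝ) (h : Z d → ℝ) (p α : ℝ) (f : ℝ → ℝ) : Set (Z d → ℝ) :=
  {u | memH W h p u ∧ u ≠ 0 ∧
    HnormP W h p u =
      ∑' x : Z d, conv d α (fun y => Fint f (pos u y)) x * f (pos u x) * pos u x}

/-- Hypothesis (f4). -/
def F4 (W : Z d → Z d → ℝ) (h : Z d → ℝ) (p α : ℝ) (f : ℝ → ℝ) : Prop :=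
  ∀ u : Z d → ℝ, memH W h p u → pos u ≠ 0 →
    StrictMonoOn (fun t : ℝ =>
      t ^ (1 - p) *
        ∑' x : Z d, conv d α (fun y => Fint f (t * pos u y)) x * f (t * pos u x) * pos u x)
      (Set.Ioi 0)

/-- The derivative pairing `⟨J̃′(u), φ⟩`. -/
def pairing (W : Z d → Z d → ℝ) (h : Z d → ℝ) (p α : ℝ) (f : ℝ → ℝ) (u φ : Z d → ℝ) : ℝ :=
  (∑' x : Z d,
      (gradNorm W u x ^ (p - 2) * gradForm W u φ x + h x * |u x| ^ (p - 2) * u x * φ x)) -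
    ∑' x : Z d, conv d α (fun y => Fint f (pos u y)) x * f (pos u x) * φ x

lemma norm_le_latDist (y : Z d) : ‖(fun i => (y i : ℝ))‖ ≤ latDist 0 y := by
  rw [pi_norm_le_iff_of_nonneg (by unfold latDist; positivity)]
  intro i
  have := Finset.single_le_sum (f := fun i => |(((0 : Z d) i - y i : ℤ) : ℝ)|)
    (fun i _ => abs_nonneg _) (Finset.mem_univ i)
  simpa [latDist] using this

lemma summable_lat {s : ℝ} (hs : 0 < s) :
    Summable fun y : Z d => ‖(fun i => (y i : ℝ))‖ ^ (-(d : ℝ) - 2 * s) := by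
  let L := Submodule.span ℤ (Set.range (Pi.basisFun ℝ (Fin d)))
  have hr : Module.finrank ℤ L = d := by
    rw [ZLattice.rank ℝ L]; simp
  have h1 := ZLattice.summable_norm_rpow L (-(d : ℝ) - 2 * s) (by rw [hr]; linarith)
  have hmem : ∀ y : Z d, (fun i => (y i : ℝ)) ∈ L := by
    intro y
    rw [Module.Basis.mem_span_iff_repr_mem]
    intro i
    simp
  have h2 := h1.comp_injective (i := fun y : Z d => (⟨fun i => (y i : ℝ), hmem y⟩ : L)) (by
    intro a b hab
    have := congrArg Subtype.val hab
    funext i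
    have := congrFun this i
    simpa using this)
  exact h2

lemma summable_W {s : ℝ} (hs : 0 < s) {W : Z d → Z d → ℝ} (hW : KernelOK d s W) :
    Summable fun y : Z d => W 0 y := by
  obtain ⟨-, hpos, c, C, hc, hcC, hb⟩ := hW
  have h1 : Summable fun y : Z d => C * ‖(fun i => (y i : ℝ))‖ ^ (-(d : ℝ) - 2 * s)
      + (Pi.single 0 (W 0 0) : Z d → ℝ) y := by
    refine ((summable_lat hs).mul_left C).add ?_
    exact (hasSum_pi_single (0 : Z d) (W 0 0)).summable
  refine Summable.of_nonneg_of_le (fun y => (hpos 0 y).le) (fun y => ?_) h1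
  by_cases hy : y = 0
  · subst hy
    rw [Pi.single_eq_same]
    have : 0 ≤ C := hc.le.trans hcC
    have : 0 ≤ C * ‖(fun i => ((0 : Z d) i : ℝ))‖ ^ (-(d : ℝ) - 2 * s) := by positivity
    linarith
  · rw [Pi.single_eq_of_ne hy, add_zero]
    refine (hb 0 y (Ne.symm hy)).2.trans ?_
    have hn : 0 < ‖(fun i => (y i : ℝ))‖ := by
      rw [norm_pos_iff]
      intro h0
      apply hy
      funext i
      have := congrFun h0 i
      simpa using this
    refine mul_le_mul_of_nonneg_left ?_ (hc.le.trans hcC)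
    apply Real.rpow_le_rpow_of_nonpos hn (norm_le_latDist y)
    have : (0 : ℝ) ≤ d := Nat.cast_nonneg d
    linarith

lemma grad_summable {s : ℝ} (hs : 0 < s) {W : Z d → Z d → ℝ} (hW : KernelOK d s W) (x : Z d) :
    Summable fun y : Z d => W x y * ((Pi.single 0 1 : Z d → ℝ) x - (Pi.single 0 1 : Z d → ℝ) y) ^ 2 := by
  by_cases hx : x = 0
  · subst hx
    refine Summable.of_nonneg_of_le (fun y => mul_nonneg (hW.2.1 0 y).le (sq_nonneg _))
      (fun y => ?_) (summable_W hs hW)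
    by_cases hy : y = 0
    · subst hy; simpa using (hW.2.1 0 0).le
    · simp [Pi.single_eq_of_ne hy]
  · apply summable_of_ne_finset_zero (s := {0})
    intro y hy
    simp at hy
    simp [Pi.single_eq_of_ne hy, Pi.single_eq_of_ne hx]

lemma memH_single {s p : ℝ} (hs : 0 < s) (hp : 2 ≤ p) {W : Z d → Z d → ℝ} (hW : KernelOK d s W)
    (h : Z d → ℝ) : memH W h p (Pi.single 0 1 : Z d → ℝ) := by
  refine ⟨grad_summable hs hW, ?_⟩
  refine Summable.add ?_ ?_
  · have hsum := (summable_W hs hW).mul_left (1/2)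
    have hz := hsum.tendsto_cofinite_zero
    have hev : ∀ᶠ x in cofinite, (1/2) * W 0 x < 1 := hz.eventually (gt_mem_nhds one_pos)
    refine Summable.of_norm_bounded_eventually hsum ?_
    have hne : ∀ᶠ x : Z d in cofinite, x ≠ 0 := by
      simp [Filter.eventually_cofinite]
    filter_upwards [hev, hne] with x hx hx0
    have hg : gradNorm W (Pi.single 0 1 : Z d → ℝ) x = Real.sqrt ((1/2) * W 0 x) := by
      unfold gradNorm
      rw [tsum_eq_single 0]
      · simp [Pi.single_eq_of_ne hx0, hW.1 x 0]
      · intro y hy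
        simp [Pi.single_eq_of_ne hy, Pi.single_eq_of_ne hx0]
    have hw := hW.2.1 0 x
    have hw0 : 0 ≤ (1/2) * W 0 x := by positivity
    rw [hg, Real.norm_of_nonneg (by positivity), Real.sqrt_eq_rpow, ← Real.rpow_mul hw0]
    calc _ ≤ ((1/2) * W 0 x) ^ (1 : ℝ) :=
          Real.rpow_le_rpow_of_exponent_ge (by positivity) hx.le (by linarith)
      _ = _ := Real.rpow_one _
  · apply summable_of_ne_finset_zero (s := {0})
    intro y hy
    simp at hy
    simp [Pi.single_eq_of_ne hy, Real.zero_rpow (show p ≠ 0 by linarith)]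

lemma gradNorm_smul (W : Z d → Z d → ℝ) (u : Z d → ℝ) {t : ℝ} (ht : 0 ≤ t) (x : Z d) :
    gradNorm W (fun y => t * u y) x = t * gradNorm W u x := by
  unfold gradNorm
  have : ∀ y, W x y * (t * u x - t * u y) ^ 2 = t ^ 2 * (W x y * (u x - u y) ^ 2) := by
    intro y; ring
  simp_rw [this]
  rw [tsum_mul_left, mul_left_comm, Real.sqrt_mul (sq_nonneg t), Real.sqrt_sq ht]

lemma term_smul (W : Z d → Z d → ℝ) (h : Z d → ℝ) (p : ℝ) (u : Z d → ℝ) {t : ℝ} (ht : 0 ≤ t)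
    (x : Z d) :
    gradNorm W (fun y => t * u y) x ^ p + h x * |t * u x| ^ p =
      t ^ p * (gradNorm W u x ^ p + h x * |u x| ^ p) := by
  rw [gradNorm_smul W u ht, Real.mul_rpow ht (show 0 ≤ gradNorm W u x from Real.sqrt_nonneg _), abs_mul, abs_of_nonneg ht,
    Real.mul_rpow ht (abs_nonneg _)]
  ring

lemma HnormP_smul (W : Z d → Z d → ℝ) (h : Z d → ℝ) (p : ℝ) (u : Z d → ℝ) {t : ℝ} (ht : 0 ≤ t) :
    HnormP W h p (fun y => t * u y) = t ^ p * HnormP W h p u := by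
  unfold HnormP
  simp_rw [term_smul W h p u ht]
  rw [tsum_mul_left]

lemma memH_smul {W : Z d → Z d → ℝ} {h : Z d → ℝ} {p : ℝ} {u : Z d → ℝ} (hu : memH W h p u)
    {t : ℝ} (ht : 0 ≤ t) : memH W h p (fun y => t * u y) := by
  refine ⟨fun x => ?_, ?_⟩
  · have : ∀ y, W x y * (t * u x - t * u y) ^ 2 = t ^ 2 * (W x y * (u x - u y) ^ 2) := by
      intro y; ring
    simp_rw [this]
    exact (hu.1 x).mul_left _
  · simp_rw [term_smul W h p u ht]
    exact hu.2.mul_left _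

lemma HnormP_pos {W : Z d → Z d → ℝ} {h : Z d → ℝ} {p : ℝ} {u : Z d → ℝ} (hu : memH W h p u)
    {h₀ : ℝ} (hh₀ : 0 < h₀) (hh1 : ∀ x, h₀ ≤ h x) {x : Z d} (hx : u x ≠ 0) :
    0 < HnormP W h p u := by
  have hn : ∀ x, 0 ≤ gradNorm W u x ^ p + h x * |u x| ^ p := fun x =>
    add_nonneg (Real.rpow_nonneg (Real.sqrt_nonneg _) _)
      (mul_nonneg (hh₀.le.trans (hh1 x)) (Real.rpow_nonneg (abs_nonneg _) _))
  refine hu.2.tsum_pos hn x ?_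
  exact add_pos_of_nonneg_of_pos (Real.rpow_nonneg (Real.sqrt_nonneg _) _)
    (mul_pos (hh₀.trans_le (hh1 x)) (Real.rpow_pos_of_pos (abs_pos.2 hx) _))

lemma F_growth {f : ℝ → ℝ} (hfc : Continuous f) {θ : ℝ} (hf3 : F3 f θ) {t : ℝ} (ht : 1 ≤ t) :
    Fint f 1 * t ^ (θ / 2) ≤ Fint f t := by
  have hder : ∀ x : ℝ, 0 < x → HasDerivAt (fun x => Fint f x * x ^ (-(θ / 2)))
      (f x * x ^ (-(θ / 2)) + Fint f x * (-(θ / 2) * x ^ (-(θ / 2) - 1))) x := by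
    intro x hx
    have h1 : HasDerivAt (Fint f) (f x) x :=
      intervalIntegral.integral_hasDerivAt_right (hfc.intervalIntegrable _ _)
        (hfc.stronglyMeasurableAtFilter _ _) hfc.continuousAt
    exact h1.mul (Real.hasDerivAt_rpow_const (Or.inl hx.ne'))
  have hmono : MonotoneOn (fun x => Fint f x * x ^ (-(θ / 2))) (Set.Ici 1) := by
    apply monotoneOn_of_deriv_nonneg (convex_Ici 1)
    · intro x hx
      exact (hder x (one_pos.trans_le hx)).continuousAt.continuousWithinAt
    · intro x hx
      rw [interior_Ici] at hx
      exact (hder x (one_pos.trans hx)).differentiableAt.differentiableWithinAt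
    · intro x hx
      rw [interior_Ici] at hx
      have hx0 : 0 < x := one_pos.trans hx
      rw [(hder x hx0).deriv]
      have h3 := (hf3 x hx0).2
      have : f x * x ^ (-(θ / 2)) + Fint f x * (-(θ / 2) * x ^ (-(θ / 2) - 1))
          = (2 * f x * x - θ * Fint f x) / 2 * x ^ (-(θ / 2) - 1) := by
        have : x ^ (-(θ / 2)) = x * x ^ (-(θ / 2) - 1) := by
          rw [Real.rpow_sub_one hx0.ne']; field_simp
        rw [this]; ring
      rw [this]
      have := Real.rpow_nonneg hx0.le (-(θ / 2) - 1)
      apply mul_nonneg _ this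
      linarith
  have h := hmono (Set.mem_Ici.2 le_rfl) (Set.mem_Ici.2 ht) ht
  have ht0 : 0 < t := one_pos.trans_le ht
  simp only [Real.one_rpow, mul_one] at h
  calc _ ≤ (Fint f t * t ^ (-(θ / 2))) * t ^ (θ / 2) :=
        mul_le_mul_of_nonneg_right h (Real.rpow_nonneg ht0.le _)
    _ = Fint f t := by rw [mul_assoc, ← Real.rpow_add ht0]; simp

lemma one_dim {β : ℝ} (hβ0 : 0 < β) (hβ : β < 1) :
    IntegrableOn (fun k : ℝ => (2 - 2 * Real.cos k) ^ (-(β / 2))) (Set.Icc 0 (2 * Real.pi)) := by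
  have hpi := Real.pi_pos
  rw [integrableOn_Icc_iff_integrableOn_Ioo]
  have h1 : IntegrableOn (fun k : ℝ => k ^ (-β)) (Set.Ioo 0 (2 * Real.pi)) :=
    (intervalIntegral.integrableOn_Ioo_rpow_iff (by positivity)).2 (by linarith)
  have h1' : IntervalIntegrable (fun k : ℝ => k ^ (-β)) volume 0 (2 * Real.pi) :=
    intervalIntegral.intervalIntegrable_rpow' (by linarith)
  have h2 : IntegrableOn (fun k : ℝ => (2 * Real.pi - k) ^ (-β)) (Set.Ioo 0 (2 * Real.pi)) := by
    have := (h1'.comp_sub_left (2 * Real.pi)).symm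
    simp only [sub_self, sub_zero] at this
    rwa [intervalIntegrable_iff_integrableOn_Ioo_of_le (by positivity)] at this
  have key : ∀ k : ℝ, 0 < k → k ≤ Real.pi → (2 - 2 * Real.cos k) ^ (-(β / 2)) ≤
      (4 / Real.pi ^ 2) ^ (-(β / 2)) * k ^ (-β) := by
    intro k hk hk2
    have hc := Real.cos_le_one_sub_mul_cos_sq (x := k) (by rw [abs_of_pos hk]; exact hk2)
    have e : k ^ (-β) = (k ^ 2) ^ (-(β / 2)) := by
      rw [← Real.rpow_natCast, ← Real.rpow_mul hk.le]; congr 1; push_cast; ring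
    rw [e, ← Real.mul_rpow (by positivity) (by positivity)]
    apply Real.rpow_le_rpow_of_nonpos (by positivity) _ (by linarith)
    have : 4 / Real.pi ^ 2 * k ^ 2 = 2 * (2 / Real.pi ^ 2 * k ^ 2) := by ring
    rw [this]; linarith
  refine Integrable.mono' ((h1.add h2).const_mul ((4 / Real.pi ^ 2) ^ (-(β / 2)))) ?_ ?_
  · exact (by fun_prop : Measurable fun k : ℝ => (2 - 2 * Real.cos k) ^ (-(β / 2))).aestronglyMeasurable
  · refine (ae_restrict_iff' measurableSet_Ioo).2 (Eventually.of_forall fun k hk => ?_)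
    have hcc := Real.cos_le_one k
    rw [Real.norm_of_nonneg (Real.rpow_nonneg (by linarith) _)]
    have hA : 0 ≤ (4 / Real.pi ^ 2) ^ (-(β / 2)) := by positivity
    have p1 : 0 ≤ k ^ (-β) := Real.rpow_nonneg hk.1.le _
    have p2 : 0 ≤ (2 * Real.pi - k) ^ (-β) := Real.rpow_nonneg (by linarith [hk.2]) _
    simp only [Pi.add_apply, mul_add]
    rcases le_total k Real.pi with hkp | hkp
    · have := key k hk.1 hkp
      have := mul_nonneg hA p2
      linarith
    · have h3 := key (2 * Real.pi - k) (by linarith [hk.2]) (by linarith)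
      rw [Real.cos_two_pi_sub] at h3
      have := mul_nonneg hA p1
      linarith

lemma vol_box : (volume : Measure (Fin d → ℝ)).restrict (box d) =
    Measure.pi fun _ => (volume : Measure ℝ).restrict (Set.Icc 0 (2 * Real.pi)) := by
  rw [box, volume_pi, Measure.restrict_pi_pi]

lemma muk_eq (k : Fin d → ℝ) : muk d k = ∑ j, (2 - 2 * Real.cos (k j)) := by
  simp [muk, Finset.sum_sub_distrib, Finset.mul_sum, mul_comm]

lemma muk_nonneg (k : Fin d → ℝ) : 0 ≤ muk d k := by
  rw [muk_eq]
  exact Finset.sum_nonneg fun j _ => by linarith [Real.cos_le_one (k j)]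

lemma muk_meas : Measurable (muk d) := by
  unfold muk; fun_prop

lemma ae_box : ∀ᵐ k ∂((volume : Measure (Fin d → ℝ)).restrict (box d)),
    ∀ j, 0 < 2 - 2 * Real.cos (k j) := by
  rw [vol_box, ae_all_iff]
  intro j
  have h1 : ∀ᵐ k ∂((volume : Measure ℝ).restrict (Set.Icc 0 (2 * Real.pi))),
      0 < 2 - 2 * Real.cos k := by
    rw [← Measure.restrict_congr_set Ioo_ae_eq_Icc]
    refine (ae_restrict_iff' measurableSet_Ioo).2 (Eventually.of_forall fun k hk => ?_)
    have : Real.cos k ≠ 1 := by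
      intro hc
      rw [Real.cos_eq_one_iff_of_lt_of_lt (by linarith [hk.1, Real.pi_pos]) hk.2] at hc
      exact hk.1.ne' hc
    have := lt_of_le_of_ne (Real.cos_le_one k) this
    linarith
  exact (Measure.tendsto_eval_ae_ae (μ := fun _ : Fin d =>
    (volume : Measure ℝ).restrict (Set.Icc 0 (2 * Real.pi))) (i := j)).eventually h1

lemma muk_pos_ae (hd : 0 < d) : ∀ᵐ k ∂((volume : Measure (Fin d → ℝ)).restrict (box d)),
    0 < muk d k := by
  filter_upwards [ae_box] with k hk
  rw [muk_eq]
  exact Finset.sum_pos (fun j _ => hk j) ⟨⟨0, hd⟩, Finset.mem_univ _⟩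

lemma muk_integrable (hd : 0 < d) {α : ℝ} (hα : α ∈ Set.Ioo (0 : ℝ) (d : ℝ)) :
    IntegrableOn (fun k => muk d k ^ (-(α / 2))) (box d) := by
  have hd' : (0 : ℝ) < d := Nat.cast_pos.2 hd
  have hI : Integrable (fun k : Fin d → ℝ => ∏ j, (2 - 2 * Real.cos (k j)) ^ (-((α / d) / 2)))
      ((volume : Measure (Fin d → ℝ)).restrict (box d)) := by
    rw [vol_box]
    exact Integrable.fintype_prod (f := fun _ k => (2 - 2 * Real.cos k) ^ (-((α / d) / 2)))
      fun _ => one_dim (div_pos hα.1 hd') ((div_lt_one hd').2 hα.2)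
  refine Integrable.mono' hI (muk_meas.pow_const _).aestronglyMeasurable ?_
  filter_upwards [ae_box] with k hk
  rw [Real.norm_of_nonneg (Real.rpow_nonneg (muk_nonneg k) _)]
  have hle : ∀ j, 2 - 2 * Real.cos (k j) ≤ muk d k := by
    intro j
    rw [muk_eq]
    exact Finset.single_le_sum (f := fun j => 2 - 2 * Real.cos (k j)) (fun i _ => (hk i).le)
      (Finset.mem_univ j)
  calc muk d k ^ (-(α / 2)) = ∏ j : Fin d, muk d k ^ (-((α / d) / 2)) := by
        rw [Finset.prod_const, Finset.card_univ, Fintype.card_fin, ← Real.rpow_natCast,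
          ← Real.rpow_mul (muk_nonneg k)]
        congr 1; field_simp
    _ ≤ _ := by
        apply Finset.prod_le_prod
        · intro j _; exact Real.rpow_nonneg (muk_nonneg k) _
        · intro j _
          apply Real.rpow_le_rpow_of_nonpos (hk j) (hle j)
          have := div_pos hα.1 hd'
          linarith

lemma integral_pos_box (g : (Fin d → ℝ) → ℝ) (hg : IntegrableOn g (box d))
    (hp : ∀ᵐ k ∂((volume : Measure (Fin d → ℝ)).restrict (box d)), 0 < g k) :
    0 < ∫ k in box d, g k := by
  rw [integral_pos_iff_support_of_nonneg_ae (hp.mono fun k hk => hk.le) hg]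
  have h0 : (volume : Measure (Fin d → ℝ)).restrict (box d) ≠ 0 := by
    rw [Ne, Measure.restrict_eq_zero, box, volume_pi, Measure.pi_pi]
    simp [Real.volume_Icc, Real.pi_pos]
  have : (volume : Measure (Fin d → ℝ)).restrict (box d) (Function.support g)
      = (volume : Measure (Fin d → ℝ)).restrict (box d) Set.univ := by
    apply measure_congr
    filter_upwards [hp] with k hk
    exact propext ⟨fun _ => trivial, fun _ => hk.ne'⟩
  rw [this]
  exact pos_iff_ne_zero.2 (by simpa using h0)

lemma Kfrac_pos (hd : 0 < d) {α : ℝ} (hα : α ∈ Set.Ioo (0 : ℝ) (d : ℝ)) : 0 < Kfrac d α := by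
  unfold Kfrac
  refine mul_pos (Real.rpow_pos_of_pos (by positivity) _) (integral_pos_box _ ?_ ?_)
  · apply ContinuousOn.integrableOn_compact
    · exact isCompact_univ_pi fun _ => isCompact_Icc
    · have : Continuous (muk d) := by unfold muk; fun_prop
      exact (this.rpow_const fun k => Or.inr (by linarith [hα.1])).continuousOn
  · filter_upwards [muk_pos_ae hd] with k hk
    exact Real.rpow_pos_of_pos hk _

lemma Riesz_pos (hd : 0 < d) {α : ℝ} (hα : α ∈ Set.Ioo (0 : ℝ) (d : ℝ)) :
    0 < Riesz d α 0 0 := by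
  unfold Riesz
  refine mul_pos (mul_pos (Kfrac_pos hd hα) (Real.rpow_pos_of_pos (by positivity) _)) ?_
  simp only [Pi.zero_apply, sub_self, Int.cast_zero, zero_mul, Finset.sum_const_zero,
    Real.cos_zero, one_mul]
  refine integral_pos_box _ (muk_integrable hd hα) ?_
  filter_upwards [muk_pos_ae hd] with k hk
  exact Real.rpow_pos_of_pos hk _

lemma energy_single (W : Z d → Z d → ℝ) (h : Z d → ℝ) (p α : ℝ) (f : ℝ → ℝ) {t : ℝ} (ht : 0 ≤ t) :
    energy W h p α f (fun y => t * (Pi.single 0 1 : Z d → ℝ) y) =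
      (1 / p) * (t ^ p * HnormP W h p (Pi.single 0 1 : Z d → ℝ)) -
        (1 / 2) * (Riesz d α 0 0 * Fint f t ^ 2) := by
  have hz : ∀ y : Z d, y ≠ 0 →
      Fint f (pos (fun y => t * (Pi.single 0 1 : Z d → ℝ) y) y) = 0 := by
    intro y hy
    simp [pos, Pi.single_eq_of_ne hy, Fint]
  have h0 : Fint f (pos (fun y => t * (Pi.single 0 1 : Z d → ℝ) y) 0) = Fint f t := by
    simp [pos, ht]
  unfold energy
  rw [HnormP_smul W h p _ ht, tsum_eq_single 0]
  · unfold conv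
    rw [tsum_eq_single 0]
    · beta_reduce; rw [h0]; ring
    · intro y hy; beta_reduce; rw [hz y hy, mul_zero]
  · intro y hy; rw [hz y hy, mul_zero]

theorem mountain_pass_geometry_ii
    {d : ℕ} (hd : 0 < d) {s p : ℝ} (hs : s ∈ Set.Ioo (0 : ℝ) 1) (hp : 2 ≤ p)
    {W : Z d → Z d → ℝ} (hW : KernelOK d s W)
    {α : ℝ} (hα : α ∈ Set.Ioo (0 : ℝ) (d : ℝ))
    {h : Z d → ℝ} {h₀ : ℝ} (hh₀ : 0 < h₀) (hh1 : ∀ x, h₀ ≤ h x)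
    {f : ℝ → ℝ} (hfc : Continuous f) (hfz : ∀ t ≤ (0 : ℝ), f t = 0)
    (hf1 : F1 f p)
    {C₀ τ : ℝ} (hC₀ : 0 < C₀) (hτ : ((d : ℝ) + α) * p / (2 * d) < τ)
    (hf2 : ∀ t > (0 : ℝ), f t ≤ C₀ * (1 + t ^ (τ - 1)))
    {θ : ℝ} (hθ : p < θ) (hf3 : F3 f θ)
    (hFpos : ∀ t > (0 : ℝ), 0 < Fint f t) :
    ∀ ρ > (0 : ℝ), ∃ e : Z d → ℝ, (∀ x, 0 ≤ e x) ∧ e ≠ 0 ∧ memH W h p e ∧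
      ρ < normH W h p e ∧ energy W h p α f e < 0 := by
  intro ρ hρ
  have hm := memH_single hs.1 hp hW h
  set N := HnormP W h p (Pi.single 0 1 : Z d → ℝ) with hN
  have hNpos : 0 < N := HnormP_pos hm hh₀ hh1 (x := 0) (by simp)
  have hR := Riesz_pos hd hα
  set R := Riesz d α 0 0 with hRdef
  have hF1 := hFpos 1 one_pos
  have hp0 : 0 < p := by linarith
  have e1 : ∀ᶠ t : ℝ in atTop, ρ ^ p / N < t ^ p :=
    (tendsto_rpow_atTop hp0).eventually_gt_atTop _
  have e2 : ∀ᶠ t : ℝ in atTop, (1 / p) * N / ((1 / 2) * (R * Fint f 1 ^ 2)) < t ^ (θ - p) :=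
    (tendsto_rpow_atTop (by linarith : 0 < θ - p)).eventually_gt_atTop _
  obtain ⟨t, ht1, ht2, ht⟩ := (e1.and (e2.and (eventually_ge_atTop (1 : ℝ)))).exists
  have ht0 : 0 < t := one_pos.trans_le ht
  refine ⟨fun y => t * (Pi.single 0 1 : Z d → ℝ) y, ?_, ?_, memH_smul hm ht0.le, ?_, ?_⟩
  · intro x
    by_cases hx : x = 0
    · subst hx; simpa using ht0.le
    · simp [Pi.single_eq_of_ne hx]
  · intro h0
    have := congrFun h0 0
    simp at this
    exact ht0.ne' this
  · unfold normH
    rw [HnormP_smul W h p _ ht0.le, ← hN]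
    have : ρ = (ρ ^ p) ^ (1 / p) := by
      rw [← Real.rpow_mul hρ.le, mul_one_div_cancel hp0.ne', Real.rpow_one]
    rw [this]
    exact Real.rpow_lt_rpow (by positivity) ((div_lt_iff₀ hNpos).1 ht1) (by positivity)
  · rw [energy_single W h p α f ht0.le, ← hN, ← hRdef]
    have hg := F_growth hfc hf3 ht
    have hsq : (Fint f 1 * t ^ (θ / 2)) ^ 2 ≤ Fint f t ^ 2 :=
      pow_le_pow_left₀ (by positivity) hg 2
    have hexp : (t ^ (θ / 2)) ^ 2 = t ^ p * t ^ (θ - p) := by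
      rw [← Real.rpow_add ht0, ← Real.rpow_natCast, ← Real.rpow_mul ht0.le]
      congr 1; push_cast; ring
    rw [mul_pow, hexp] at hsq
    rw [div_lt_iff₀ (by positivity)] at ht2
    have htp : 0 < t ^ p := by positivity
    have h1 := mul_lt_mul_of_pos_left ht2 htp
    have h2 := mul_le_mul_of_nonneg_left hsq hR.le
    nlinarith [h1, h2]

end DiscreteChoquard
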